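/- For any σ-finite measure λ ≺ μ, the transition probabilities p and the cotransition probabilities p̌ of the chain with initial distribution λ satisfy (dλ/dμ)(x) p(x,y) = (dλP/dμ)(y) p̌(y,x) Δ(x,y) for Μ-almost every pair (x,y) ∈ R, where Μ is the left counting measure on R; in particular, if λ is P-stationary then the cotransition probabilities are given by p̌(y,x) = p(x,y) Δ_λ(y,x), where Δ_λ is the Radon–Nikodym cocycle of λ, and they determine another Markov chain along the equivalence classes (the time reversal) with the same stationary measure λ. -/

import Mathlib

open Filter
open scoped ENNReal

/-! ## Discrete measured equivalence relations

A discrete measured equivalence relation `R` on a Lebesgue measure space `(X,μ)` with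
countable classes, together with its multiplicative Radon–Nikodym cocycle
`Δ = Δ_μ : R → ℝ₊`.  The cocycle is characterized by the identity
`dΜ̌ = Δ dΜ` between the right and the left counting measures on `R`, which we encode by
the "mass transport" identity `∫ Σ_{y∈[x]} F(y,x) dμ(x) = ∫ Σ_{y∈[x]} F(x,y) Δ(x,y) dμ(x)`
for all nonnegative measurable kernels `F` supported on `R`. -/
structure DiscEqRel where
  X : Type
  [mX : MeasurableSpace X]
  μ : MeasureTheory.Measure X
  R : X → X → Prop
  requiv : Equivalence R
  rcount : ∀ x : X, {y | R x y}.Countable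
  rmeas : MeasurableSet {q : X × X | R q.1 q.2}
  Δ : X → X → ℝ≥0∞
  Δmeas : Measurable (Function.uncurry Δ)
  Δpos : ∀ x y, R x y → 0 < Δ x y ∧ Δ x y ≠ ∞
  Δcocycle : ∀ x y z, R x y → R y z → Δ x z = Δ x y * Δ y z
  Δrn : ∀ F : X → X → ℝ≥0∞, Measurable (Function.uncurry F) →
    (∀ x y, ¬ R x y → F x y = 0) →
    (MeasureTheory.lintegral μ (fun x => ∑' y : {y // R x y}, F (y : X) x))
      = MeasureTheory.lintegral μ (fun x => ∑' y : {y // R x y}, F x (y : X) * Δ x (y : X))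

attribute [instance] DiscEqRel.mX

open MeasureTheory

namespace DiscEqRel

/-- The property of `D` being the Radon–Nikodym cocycle of a measure `ν` quasi-invariant
under the equivalence relation (the same mass transport identity as for `Δ_μ`). -/
def IsRNCocycle (E : DiscEqRel) (ν : Measure E.X) (D : E.X → E.X → ℝ≥0∞) : Prop :=
  ∀ F : E.X → E.X → ℝ≥0∞, Measurable (Function.uncurry F) →
    (∀ x y, ¬ E.R x y → F x y = 0) →
    ∫⁻ x, (∑' y : {y // E.R x y}, F (y : E.X) x) ∂ν
      = ∫⁻ x, (∑' y : {y // E.R x y}, F x (y : E.X) * D x (y : E.X)) ∂ν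

/-- The transition kernel of a leafwise random walk: the measure `π_x = Σ_y p(x,y) δ_y`
on the class of `x`. -/
noncomputable def kern (E : DiscEqRel) (p : E.X → E.X → ℝ≥0∞) (x : E.X) :
    Measure E.X :=
  Measure.sum (fun y : {y // E.R x y} => p x (y : E.X) • Measure.dirac (y : E.X))

/-- The left counting measure on `R ⊂ X × X` associated with a measure `ν` on `X`:
`dΜ(x,y) = dν(x) dν_x(y)` where `ν_x` is the counting measure on the class `[x]`. -/
noncomputable def pairCount (E : DiscEqRel) (ν : Measure E.X) : Measure (E.X × E.X) :=
  ν.bind (fun x => Measure.sum (fun y : {y // E.R x y} => Measure.dirac (x, (y : E.X))))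

/-- The joint distribution `dΠ(x,y) = dν(x) p(x,y)` of the positions of the chain with
initial distribution `ν` at times `0` and `1`, as a measure on `X × X`. -/
noncomputable def joint (E : DiscEqRel) (p : E.X → E.X → ℝ≥0∞) (ν : Measure E.X) :
    Measure (E.X × E.X) :=
  ν.bind (fun x =>
    Measure.sum (fun y : {y // E.R x y} => p x (y : E.X) • Measure.dirac (x, (y : E.X))))

end DiscEqRel

/-- A random walk along the classes of a discrete measured equivalence relation: a
measurable family of transition probabilities `π_x`, each concentrated on the class of
`x`, with `p(x,y) = π_x({y})`. -/
structure RWData (E : DiscEqRel) where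
  p : E.X → E.X → ℝ≥0∞
  pmeas : Measurable (Function.uncurry p)
  psupp : ∀ x y, ¬ E.R x y → p x y = 0
  ptotal : ∀ x, (∑' y : {y // E.R x y}, p x (y : E.X)) = 1

/-- Two measurable densities of the same `σ`-finite measure agree almost everywhere, whatever the
reference measure. -/
theorem ae_eq_of_withDensity_eq_of_sigmaFinite {α : Type*} [MeasurableSpace α] {M : Measure α}
    {F G : α → ℝ≥0∞} (hF : Measurable F) (hG : Measurable G) [SigmaFinite (M.withDensity F)]
    (h : M.withDensity F = M.withDensity G) : F =ᵐ[M] G := by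
  set S := spanningSets (M.withDensity F) with hS
  have hm : ∀ n, MeasurableSet (S n) := measurableSet_spanningSets _
  have key : ∀ n, ∀ᵐ x ∂M.restrict (S n), F x = G x := by
    intro n
    refine (withDensity_eq_iff hF.aemeasurable hG.aemeasurable ?_).1 ?_
    · rw [← withDensity_apply _ (hm n)]
      exact (measure_spanningSets_lt_top _ n).ne
    · rw [← restrict_withDensity (hm n), ← restrict_withDensity (hm n), h]
  have := (ae_restrict_iUnion_iff S (fun x => F x = G x)).2 key
  rwa [hS, iUnion_spanningSets, Measure.restrict_univ] at this

theorem bind_of_not_aemeasurable {α β : Type*} [MeasurableSpace α] [MeasurableSpace β]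
    {ν : Measure α} {K : α → Measure β} (h : ¬ AEMeasurable K ν) : ν.bind K = 0 := by
  rw [Measure.bind, Measure.map_of_not_aemeasurable h, Measure.join_zero]

theorem lintegral_sum_smul_dirac {ι α : Type*} [MeasurableSpace α] (w : ι → ℝ≥0∞) (g : ι → α)
    {H : α → ℝ≥0∞} (hH : Measurable H) :
    ∫⁻ z, H z ∂(Measure.sum fun i => w i • Measure.dirac (g i)) = ∑' i, w i * H (g i) := by
  simp [lintegral_sum_measure, lintegral_smul_measure, lintegral_dirac' _ hH]

theorem measurable_withDensity_left {β : Type*} [MeasurableSpace β] {g : β → ℝ≥0∞}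
    (hg : Measurable g) : Measurable fun m : Measure β => m.withDensity g := by
  refine Measure.measurable_of_measurable_coe _ fun s hs => ?_
  simp_rw [withDensity_apply g hs, ← lintegral_indicator hs]
  exact Measure.measurable_lintegral (hg.indicator hs)

theorem aemeasurable_map_prodMk {α β : Type*} [MeasurableSpace α] [MeasurableSpace β]
    {ν : Measure α} {K : α → Measure β} (hK : AEMeasurable K ν) (h1 : ∀ x, K x Set.univ = 1) :
    AEMeasurable (fun x => (K x).map (Prod.mk x)) ν := by
  classical
  let T : Set α := {x | hK.mk K x Set.univ = 1}
  have hT : MeasurableSet T :=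
    measurableSet_eq_fun ((Measure.measurable_coe MeasurableSet.univ).comp hK.measurable_mk)
      measurable_const
  let κ : ProbabilityTheory.Kernel α β :=
    ⟨T.piecewise (hK.mk K) (fun _ => 0), hK.measurable_mk.piecewise hT measurable_const⟩
  have hκ : ProbabilityTheory.IsFiniteKernel κ := by
    refine ⟨1, ENNReal.one_lt_top, fun x => ?_⟩
    change T.piecewise (hK.mk K) (fun _ => 0) x Set.univ ≤ 1
    by_cases hx : x ∈ T
    · rw [Set.piecewise_eq_of_mem _ _ _ hx]; exact le_of_eq hx
    · rw [Set.piecewise_eq_of_notMem _ _ _ hx]; simp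
  refine ⟨fun x => (κ x).map (Prod.mk x), ?_, ?_⟩
  · refine Measure.measurable_of_measurable_coe _ fun s hs => ?_
    simp_rw [Measure.map_apply measurable_prodMk_left hs]
    exact ProbabilityTheory.Kernel.measurable_kernel_prodMk_left hs
  · filter_upwards [hK.ae_eq_mk] with x hx
    have hxT : x ∈ T := by
      change hK.mk K x Set.univ = 1
      rw [← hx, h1]
    have : κ x = K x := by
      change T.piecewise (hK.mk K) (fun _ => 0) x = _
      rw [Set.piecewise_eq_of_mem _ _ _ hxT, hx]
    rw [this]

namespace DiscEqRel

variable (E : DiscEqRel)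

/-- The counting measure on the class of `x`, placed on the fibre `{x} × [x]` of `R`. -/
noncomputable def countKer (x : E.X) : Measure (E.X × E.X) :=
  Measure.sum (fun y : {y // E.R x y} => Measure.dirac (x, (y : E.X)))

/-- The law of the pair `(x, y)` with `y` distributed according to `p x`. -/
noncomputable def jointKer (p : E.X → E.X → ℝ≥0∞) (x : E.X) : Measure (E.X × E.X) :=
  Measure.sum (fun y : {y // E.R x y} => p x (y : E.X) • Measure.dirac (x, (y : E.X)))

/-- The law of the pair `(x, y)` with `x` distributed according to `p y`. -/
noncomputable def revKer (p : E.X → E.X → ℝ≥0∞) (y : E.X) : Measure (E.X × E.X) :=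
  Measure.sum (fun x : {x // E.R y x} => p y (x : E.X) • Measure.dirac ((x : E.X), y))

variable {E} {p : E.X → E.X → ℝ≥0∞} {ν : Measure E.X}

theorem lintegral_countKer (x : E.X) {H : E.X × E.X → ℝ≥0∞} (hH : Measurable H) :
    ∫⁻ z, H z ∂E.countKer x = ∑' y : {y // E.R x y}, H (x, y) := by
  simp [countKer, lintegral_sum_measure, lintegral_dirac' _ hH]

theorem lintegral_jointKer (x : E.X) {H : E.X × E.X → ℝ≥0∞} (hH : Measurable H) :
    ∫⁻ z, H z ∂E.jointKer p x = ∑' y : {y // E.R x y}, p x y * H (x, y) :=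
  lintegral_sum_smul_dirac _ _ hH

theorem lintegral_revKer (y : E.X) {H : E.X × E.X → ℝ≥0∞} (hH : Measurable H) :
    ∫⁻ z, H z ∂E.revKer p y = ∑' x : {x // E.R y x}, p y x * H (x, y) :=
  lintegral_sum_smul_dirac _ _ hH

theorem lintegral_kern (x : E.X) {H : E.X → ℝ≥0∞} (hH : Measurable H) :
    ∫⁻ z, H z ∂E.kern p x = ∑' y : {y // E.R x y}, p x y * H y :=
  lintegral_sum_smul_dirac _ _ hH

theorem jointKer_eq_withDensity (hp : Measurable (Function.uncurry p)) (x : E.X) :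
    E.jointKer p x = (E.countKer x).withDensity (Function.uncurry p) := by
  refine Measure.ext_of_lintegral _ fun H hH => ?_
  rw [lintegral_jointKer x hH, lintegral_withDensity_eq_lintegral_mul _ hp hH,
    lintegral_countKer x (hp.mul hH)]
  rfl

theorem map_swap_jointKer (x : E.X) : E.revKer p x = (E.jointKer p x).map Prod.swap := by
  refine Measure.ext_of_lintegral _ fun H hH => ?_
  rw [lintegral_revKer x hH, lintegral_map hH measurable_swap,
    lintegral_jointKer x (H := fun z => H z.swap) (hH.comp measurable_swap)]
  rfl

theorem map_snd_jointKer (x : E.X) : E.kern p x = (E.jointKer p x).map Prod.snd := by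
  refine Measure.ext_of_lintegral _ fun H hH => ?_
  rw [lintegral_kern x hH, lintegral_map hH measurable_snd,
    lintegral_jointKer x (H := fun z => H z.2) (hH.comp measurable_snd)]

theorem map_fst_revKer (x : E.X) : E.kern p x = (E.revKer p x).map Prod.fst := by
  refine Measure.ext_of_lintegral _ fun H hH => ?_
  rw [lintegral_kern x hH, lintegral_map hH measurable_fst,
    lintegral_revKer x (H := fun z => H z.1) (hH.comp measurable_fst)]

theorem map_prodMk_kern (x : E.X) : E.jointKer p x = (E.kern p x).map (Prod.mk x) := by
  refine Measure.ext_of_lintegral _ fun H hH => ?_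
  rw [lintegral_jointKer x hH, lintegral_map hH measurable_prodMk_left,
    lintegral_kern x (H := fun z => H (x, z)) (hH.comp measurable_prodMk_left)]

theorem aemeasurable_jointKer_of_countKer (hC : AEMeasurable E.countKer ν)
    (hp : Measurable (Function.uncurry p)) : AEMeasurable (E.jointKer p) ν := by
  rw [funext (jointKer_eq_withDensity hp)]
  exact (measurable_withDensity_left hp).comp_aemeasurable hC

theorem aemeasurable_revKer (hJ : AEMeasurable (E.jointKer p) ν) : AEMeasurable (E.revKer p) ν := by
  rw [funext (map_swap_jointKer (p := p))]
  exact (Measure.measurable_map _ measurable_swap).comp_aemeasurable hJ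

theorem aemeasurable_kern_of_jointKer (hJ : AEMeasurable (E.jointKer p) ν) :
    AEMeasurable (E.kern p) ν := by
  rw [funext (map_snd_jointKer (p := p))]
  exact (Measure.measurable_map _ measurable_snd).comp_aemeasurable hJ

theorem aemeasurable_kern_of_revKer (hB : AEMeasurable (E.revKer p) ν) :
    AEMeasurable (E.kern p) ν := by
  rw [funext (map_fst_revKer (p := p))]
  exact (Measure.measurable_map _ measurable_fst).comp_aemeasurable hB

theorem aemeasurable_jointKer_of_kern (hK : AEMeasurable (E.kern p) ν)
    (h1 : ∀ x, (∑' y : {y // E.R x y}, p x (y : E.X)) = 1) : AEMeasurable (E.jointKer p) ν := by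
  rw [funext (map_prodMk_kern (p := p))]
  refine aemeasurable_map_prodMk hK fun x => ?_
  rw [← lintegral_one, lintegral_kern x measurable_const]
  simp [h1]

theorem lintegral_pairCount (hC : AEMeasurable E.countKer ν) {H : E.X × E.X → ℝ≥0∞}
    (hH : Measurable H) :
    ∫⁻ z, H z ∂E.pairCount ν = ∫⁻ x, ∑' y : {y // E.R x y}, H (x, y) ∂ν := by
  refine (Measure.lintegral_bind hC hH.aemeasurable).trans ?_
  exact lintegral_congr fun x => lintegral_countKer x hH

theorem lintegral_joint (hJ : AEMeasurable (E.jointKer p) ν) {H : E.X × E.X → ℝ≥0∞}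
    (hH : Measurable H) :
    ∫⁻ z, H z ∂E.joint p ν = ∫⁻ x, ∑' y : {y // E.R x y}, p x y * H (x, y) ∂ν := by
  refine (Measure.lintegral_bind hJ hH.aemeasurable).trans ?_
  exact lintegral_congr fun x => lintegral_jointKer x hH

theorem lintegral_bind_revKer (hB : AEMeasurable (E.revKer p) ν) {H : E.X × E.X → ℝ≥0∞}
    (hH : Measurable H) :
    ∫⁻ z, H z ∂ν.bind (E.revKer p) = ∫⁻ y, ∑' x : {x // E.R y x}, p y x * H (x, y) ∂ν := by
  refine (Measure.lintegral_bind hB hH.aemeasurable).trans ?_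
  exact lintegral_congr fun x => lintegral_revKer x hH

theorem lintegral_bind_kern (hK : AEMeasurable (E.kern p) ν) {H : E.X → ℝ≥0∞}
    (hH : Measurable H) :
    ∫⁻ z, H z ∂ν.bind (E.kern p) = ∫⁻ x, ∑' y : {y // E.R x y}, p x y * H y ∂ν := by
  refine (Measure.lintegral_bind hK hH.aemeasurable).trans ?_
  exact lintegral_congr fun x => lintegral_kern x hH

theorem aemeasurable_tsum (hC : AEMeasurable E.countKer ν) {H : E.X × E.X → ℝ≥0∞}
    (hH : Measurable H) : AEMeasurable (fun x => ∑' y : {y // E.R x y}, H (x, y)) ν := by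
  simp_rw [← fun x => lintegral_countKer x hH]
  exact (Measure.measurable_lintegral hH).comp_aemeasurable hC

theorem map_fst_joint (hJ : AEMeasurable (E.jointKer p) ν)
    (h1 : ∀ x, (∑' y : {y // E.R x y}, p x (y : E.X)) = 1) : (E.joint p ν).map Prod.fst = ν := by
  refine Measure.ext_of_lintegral _ fun H hH => ?_
  rw [lintegral_map hH measurable_fst, lintegral_joint hJ
    (H := fun z => H z.1) (hH.comp measurable_fst)]
  simp_rw [ENNReal.tsum_mul_right, h1, one_mul]

theorem map_snd_joint (hJ : AEMeasurable (E.jointKer p) ν) :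
    (E.joint p ν).map Prod.snd = ν.bind (E.kern p) := by
  refine Measure.ext_of_lintegral _ fun H hH => ?_
  rw [lintegral_map hH measurable_snd, lintegral_joint hJ
    (H := fun z => H z.2) (hH.comp measurable_snd),
    lintegral_bind_kern (aemeasurable_kern_of_jointKer hJ) hH]

theorem joint_eq_withDensity (hC : AEMeasurable E.countKer ν)
    (hp : Measurable (Function.uncurry p)) :
    E.joint p ν = (E.pairCount ν).withDensity (Function.uncurry p) := by
  refine Measure.ext_of_lintegral _ fun H hH => ?_
  rw [lintegral_joint (aemeasurable_jointKer_of_countKer hC hp) hH,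
    lintegral_withDensity_eq_lintegral_mul _ hp hH, lintegral_pairCount hC (hp.mul hH)]
  rfl

theorem bind_kern_absolutelyContinuous (hC : AEMeasurable E.countKer E.μ)
    (hp : Measurable (Function.uncurry p)) (psupp : ∀ x y, ¬ E.R x y → p x y = 0)
    (hν : ν ≪ E.μ) [SigmaFinite E.μ] [SigmaFinite ν] : ν.bind (E.kern p) ≪ E.μ := by
  have hJ := aemeasurable_jointKer_of_countKer hC hp
  refine Measure.AbsolutelyContinuous.mk fun A hA hA0 => ?_
  have hind : Measurable (A.indicator (1 : E.X → ℝ≥0∞)) := measurable_one.indicator hA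
  have hq : Measurable fun q : E.X × E.X => p q.1 q.2 * A.indicator 1 q.2 :=
    hp.mul (hind.comp measurable_snd)
  rw [← lintegral_indicator_one hA,
    lintegral_bind_kern ((aemeasurable_kern_of_jointKer hJ).mono_ac hν) hind,
    ← lintegral_rnDeriv_mul hν (aemeasurable_tsum hC hq)]
  simp_rw [← ENNReal.tsum_mul_left]
  have hf := Measure.measurable_rnDeriv ν E.μ
  refine (E.Δrn (fun y x => ν.rnDeriv E.μ x * (p x y * A.indicator 1 y)) ?_ ?_).trans ?_
  · exact (hf.comp measurable_snd).mul (hq.comp measurable_swap)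
  · intro x y hxy
    simp [psupp y x fun h => hxy (E.requiv.symm h)]
  · have : ∀ᵐ x ∂E.μ, x ∉ A := measure_eq_zero_iff_ae_notMem.1 hA0
    rw [lintegral_congr_ae (g := 0), lintegral_zero_fun]
    filter_upwards [this] with x hx
    simp [hx]

theorem joint_eq_withDensity_rnDeriv (hC : AEMeasurable E.countKer E.μ)
    (hp : Measurable (Function.uncurry p)) (hν : ν ≪ E.μ) [SigmaFinite E.μ] [SFinite ν] :
    E.joint p ν = (E.pairCount E.μ).withDensity
      (fun q => ν.rnDeriv E.μ q.1 * p q.1 q.2) := by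
  have hf := Measure.measurable_rnDeriv ν E.μ
  have hd : Measurable fun q : E.X × E.X => ν.rnDeriv E.μ q.1 * p q.1 q.2 :=
    (hf.comp measurable_fst).mul hp
  refine Measure.ext_of_lintegral _ fun H hH => ?_
  rw [lintegral_joint ((aemeasurable_jointKer_of_countKer hC hp).mono_ac hν) hH,
    ← lintegral_rnDeriv_mul hν
      (aemeasurable_tsum hC (H := fun q => p q.1 q.2 * H q) (hp.mul hH)),
    lintegral_withDensity_eq_lintegral_mul _ hd hH, lintegral_pairCount hC (hd.mul hH)]
  simp only [← ENNReal.tsum_mul_left, Pi.mul_apply, mul_assoc]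

theorem bind_revKer_eq_withDensity_rnDeriv (hC : AEMeasurable E.countKer E.μ)
    (hp : Measurable (Function.uncurry p)) (psupp : ∀ x y, ¬ E.R x y → p x y = 0)
    (hν : ν ≪ E.μ) [SigmaFinite E.μ] [SFinite ν] :
    ν.bind (E.revKer p) = (E.pairCount E.μ).withDensity
      (fun q => ν.rnDeriv E.μ q.2 * p q.2 q.1 * E.Δ q.1 q.2) := by
  have hf := Measure.measurable_rnDeriv ν E.μ
  have hps : Measurable fun q : E.X × E.X => p q.2 q.1 := hp.comp measurable_swap
  have hd : Measurable fun q : E.X × E.X => ν.rnDeriv E.μ q.2 * p q.2 q.1 * E.Δ q.1 q.2 :=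
    ((hf.comp measurable_snd).mul hps).mul E.Δmeas
  refine Measure.ext_of_lintegral _ fun H hH => ?_
  rw [lintegral_bind_revKer
      ((aemeasurable_revKer (aemeasurable_jointKer_of_countKer hC hp)).mono_ac hν) hH,
    ← lintegral_rnDeriv_mul hν (aemeasurable_tsum hC (H := fun q => p q.1 q.2 * H (q.2, q.1))
      (hp.mul (hH.comp measurable_swap))),
    lintegral_withDensity_eq_lintegral_mul _ hd hH, lintegral_pairCount hC (hd.mul hH)]
  simp only [← ENNReal.tsum_mul_left]
  refine (E.Δrn (fun x y => ν.rnDeriv E.μ y * (p y x * H (x, y))) ?_ ?_).trans ?_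
  · exact (hf.comp measurable_snd).mul (hps.mul hH)
  · intro x y hxy
    simp [psupp y x fun h => hxy (E.requiv.symm h)]
  · refine lintegral_congr fun x => tsum_congr fun y => ?_
    simp only [Pi.mul_apply]
    ring

theorem map_swap_joint_eq_withDensity (hC : AEMeasurable E.countKer ν)
    (hp : Measurable (Function.uncurry p)) (psupp : ∀ x y, ¬ E.R x y → p x y = 0)
    {D : E.X → E.X → ℝ≥0∞} (hDm : Measurable (Function.uncurry D)) (hD : E.IsRNCocycle ν D) :
    (E.joint p ν).map Prod.swap
      = (E.pairCount ν).withDensity (fun q => p q.2 q.1 * D q.1 q.2) := by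
  have hps : Measurable fun q : E.X × E.X => p q.2 q.1 := hp.comp measurable_swap
  have hd : Measurable fun q : E.X × E.X => p q.2 q.1 * D q.1 q.2 := hps.mul hDm
  refine Measure.ext_of_lintegral _ fun H hH => ?_
  rw [lintegral_map hH measurable_swap,
    lintegral_joint (aemeasurable_jointKer_of_countKer hC hp)
      (H := fun z => H z.swap) (hH.comp measurable_swap),
    lintegral_withDensity_eq_lintegral_mul _ hd hH, lintegral_pairCount hC (hd.mul hH)]
  refine (hD (fun x y => p y x * H (x, y)) (hps.mul hH) ?_).trans ?_
  · intro x y hxy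
    simp [psupp y x fun h => hxy (E.requiv.symm h)]
  · refine lintegral_congr fun x => tsum_congr fun y => ?_
    simp only [Pi.mul_apply]
    ring

theorem map_swap_bind_revKer (hJ : AEMeasurable (E.jointKer p) ν) :
    (ν.bind (E.revKer p)).map Prod.swap = E.joint p ν := by
  refine Measure.ext_of_lintegral _ fun H hH => ?_
  rw [lintegral_map hH measurable_swap,
    lintegral_bind_revKer (aemeasurable_revKer hJ)
      (H := fun z => H z.swap) (hH.comp measurable_swap),
    lintegral_joint hJ hH]
  rfl

/-- The left counting measure of a measure with a Radon–Nikodym cocycle is quasi-invariant under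
the flip of `R`. -/
theorem ae_pairCount_swap (hC : AEMeasurable E.countKer ν) {D : E.X → E.X → ℝ≥0∞}
    (hDm : Measurable (Function.uncurry D)) (hD : E.IsRNCocycle ν D) {P : E.X × E.X → Prop}
    (hP : MeasurableSet {q | P q}) (h : ∀ᵐ q ∂E.pairCount ν, P q) :
    ∀ᵐ q ∂E.pairCount ν, P q.swap := by
  let B : Set (E.X × E.X) := {q | P q}ᶜ ∩ {q | E.R q.1 q.2}
  have hB : MeasurableSet B := hP.compl.inter E.rmeas
  have hBi : Measurable (B.indicator (1 : E.X × E.X → ℝ≥0∞)) := measurable_one.indicator hB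
  have hPc : Measurable ({q | P q}ᶜ.indicator (1 : E.X × E.X → ℝ≥0∞)) :=
    measurable_one.indicator hP.compl
  have e := hD (fun x y => B.indicator 1 (x, y)) hBi
    (fun x y hxy => Set.indicator_of_notMem (fun hq => hxy hq.2) _)
  have e0 : ∫⁻ x, ∑' y : {y // E.R x y}, B.indicator 1 (x, (y : E.X)) * D x y ∂ν = 0 := by
    refine (lintegral_pairCount hC (hBi.mul hDm)).symm.trans ?_
    rw [lintegral_congr_ae (g := 0), lintegral_zero_fun]
    filter_upwards [h] with q hq
    have : q ∉ B := fun hqB => hqB.1 hq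
    simp [this]
  rw [e0] at e
  change (E.pairCount ν) (Prod.swap ⁻¹' {q | P q}ᶜ) = 0
  rw [← lintegral_indicator_one (measurable_swap hP.compl)]
  change ∫⁻ q, {q | P q}ᶜ.indicator (1 : E.X × E.X → ℝ≥0∞) (Prod.swap q) ∂E.pairCount ν = 0
  rw [lintegral_pairCount hC
    (H := fun q => {q | P q}ᶜ.indicator (1 : E.X × E.X → ℝ≥0∞) q.swap)
    (hPc.comp measurable_swap), ← e]
  refine lintegral_congr fun x => tsum_congr fun y => ?_
  have hr : E.R y x := E.requiv.symm y.2
  by_cases hq : P ((y : E.X), x) <;> simp [B, Set.indicator, hq, hr]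

end DiscEqRel

/-! ## STATEMENT 8: transition vs. cotransition probabilities.

For a σ-finite `λ ≺ μ`, if `p̌` are the cotransition probabilities of the chain with
initial distribution `λ` (defined by the disintegration `dΠ(x,y) = d(λP)(y) p̌(y,x)` of the
joint distribution `Π` over its second coordinate), then
`(dλ/dμ)(x) p(x,y) = (dλP/dμ)(y) p̌(y,x) Δ(x,y)` for `Μ`-a.e. `(x,y) ∈ R`, where `Μ` is the
left counting measure on `R` built on `μ`.  In particular, if `λ` is `P`-stationary then
`p̌(y,x) = p(x,y) Δ_λ(y,x)` (with `Δ_λ` the Radon–Nikodym cocycle of `λ`), and the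
cotransition probabilities determine another Markov chain along the equivalence classes
(the time reversal) with the same stationary measure `λ`. -/
theorem cotransition_probabilities (E : DiscEqRel) [SigmaFinite E.μ] (W : RWData E)
    (lam : Measure E.X) (hac : lam ≪ E.μ) [SigmaFinite lam]
    (pc : E.X → E.X → ℝ≥0∞) (pcmeas : Measurable (Function.uncurry pc))
    (pcsupp : ∀ x y, ¬ E.R x y → pc x y = 0)
    -- `p̌` disintegrates `Π` over its second coordinate: `dΠ(x,y) = d(λP)(y) p̌(y,x)`
    (hdis : E.joint W.p lam
      = (lam.bind (E.kern W.p)).bind (fun y =>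
          Measure.sum (fun x : {x // E.R y x} => pc y (x : E.X) • Measure.dirac ((x : E.X), y)))) :
    (∀ᵐ q ∂(E.pairCount E.μ),
        lam.rnDeriv E.μ q.1 * W.p q.1 q.2
          = (lam.bind (E.kern W.p)).rnDeriv E.μ q.2 * pc q.2 q.1 * E.Δ q.1 q.2) ∧
    (lam.bind (E.kern W.p) = lam →
      ∀ Δlam : E.X → E.X → ℝ≥0∞, Measurable (Function.uncurry Δlam) →
        E.IsRNCocycle lam Δlam →
        (∀ᵐ q ∂(E.pairCount lam), pc q.2 q.1 = W.p q.1 q.2 * Δlam q.2 q.1) ∧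
        (∀ᵐ y ∂lam, (∑' x : {x // E.R y x}, pc y (x : E.X)) = 1) ∧
        lam.bind (E.kern pc) = lam) := by
  change E.joint W.p lam = (lam.bind (E.kern W.p)).bind (E.revKer pc) at hdis
  refine ⟨?_, ?_⟩
  · by_cases hC : AEMeasurable E.countKer E.μ
    swap
    · have : E.pairCount E.μ = 0 := bind_of_not_aemeasurable hC
      rw [this]
      simp
    have hJ := (DiscEqRel.aemeasurable_jointKer_of_countKer hC W.pmeas).mono_ac hac
    have hσ : SigmaFinite (E.joint W.p lam) := by
      refine SigmaFinite.of_map _ measurable_fst.aemeasurable ?_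
      rwa [DiscEqRel.map_fst_joint hJ W.ptotal]
    have hs : SFinite (lam.bind (E.kern W.p)) := by
      rw [← DiscEqRel.map_snd_joint hJ]
      infer_instance
    have hρ := DiscEqRel.bind_kern_absolutelyContinuous hC W.pmeas W.psupp hac
    have e1 := DiscEqRel.joint_eq_withDensity_rnDeriv hC W.pmeas hac
    rw [DiscEqRel.bind_revKer_eq_withDensity_rnDeriv hC pcmeas pcsupp hρ, e1] at hdis
    rw [e1] at hσ
    exact ae_eq_of_withDensity_eq_of_sigmaFinite
      (((Measure.measurable_rnDeriv _ _).comp measurable_fst).mul W.pmeas)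
      ((((Measure.measurable_rnDeriv _ _).comp measurable_snd).mul
        (pcmeas.comp measurable_swap)).mul E.Δmeas) hdis
  · intro hstat D hDm hD
    rw [hstat] at hdis
    rcases eq_or_ne lam 0 with h0 | h0
    · subst h0
      simp [DiscEqRel.pairCount]
    have hK : AEMeasurable (E.kern W.p) lam := by
      by_contra hK
      exact h0 (hstat.symm.trans (bind_of_not_aemeasurable hK))
    have hJ := DiscEqRel.aemeasurable_jointKer_of_kern hK W.ptotal
    have hfst := DiscEqRel.map_fst_joint hJ W.ptotal
    have hsnd := (DiscEqRel.map_snd_joint hJ).trans hstat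
    have hB : AEMeasurable (E.revKer pc) lam := by
      by_contra hB
      rw [hdis, bind_of_not_aemeasurable hB, Measure.map_zero] at hfst
      exact h0 hfst.symm
    have htot : ∀ᵐ y ∂lam, (∑' x : {x // E.R y x}, pc y (x : E.X)) = 1 := by
      have hm : AEMeasurable (fun y => ∑' x : {x // E.R y x}, pc y (x : E.X)) lam := by
        have := (Measure.measurable_coe MeasurableSet.univ).comp_aemeasurable hB
        refine this.congr (Eventually.of_forall fun y => ?_)
        simp only [Function.comp]
        rw [← lintegral_one, DiscEqRel.lintegral_revKer y measurable_const]
        simp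
      refine (withDensity_eq_iff_of_sigmaFinite hm aemeasurable_const).1 ?_
      rw [withDensity_const, one_smul]
      refine Measure.ext fun s hs => ?_
      have hi : Measurable (s.indicator (1 : E.X → ℝ≥0∞)) := measurable_one.indicator hs
      rw [withDensity_apply _ hs, ← lintegral_indicator hs]
      conv_rhs => rw [← lintegral_indicator_one hs, ← hsnd, lintegral_map hi measurable_snd, hdis,
        DiscEqRel.lintegral_bind_revKer hB
          (H := fun z => s.indicator (1 : E.X → ℝ≥0∞) z.2) (hi.comp measurable_snd)]
      refine lintegral_congr fun y => ?_
      simp_rw [ENNReal.tsum_mul_right]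
      by_cases hy : y ∈ s <;> simp [hy]
    refine ⟨?_, htot, ?_⟩
    · by_cases hC : AEMeasurable E.countKer lam
      swap
      · have : E.pairCount lam = 0 := bind_of_not_aemeasurable hC
        rw [this]
        simp
      have hJc := DiscEqRel.aemeasurable_jointKer_of_countKer hC pcmeas
      have hpairs : E.joint pc lam = (E.joint W.p lam).map Prod.swap := by
        rw [hdis, DiscEqRel.map_swap_bind_revKer hJc]
      have hσ : SigmaFinite (E.joint pc lam) := by
        refine SigmaFinite.of_map _ measurable_fst.aemeasurable ?_
        rw [hpairs, Measure.map_map measurable_fst measurable_swap]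
        change SigmaFinite ((E.joint W.p lam).map Prod.snd)
        rwa [hsnd]
      have e1 := DiscEqRel.joint_eq_withDensity hC pcmeas
      rw [e1, DiscEqRel.map_swap_joint_eq_withDensity hC W.pmeas W.psupp hDm hD] at hpairs
      rw [e1] at hσ
      have hG : Measurable fun q : E.X × E.X => W.p q.2 q.1 * D q.1 q.2 :=
        (W.pmeas.comp measurable_swap).mul hDm
      have hae : ∀ᵐ q ∂E.pairCount lam, pc q.1 q.2 = W.p q.2 q.1 * D q.1 q.2 :=
        ae_eq_of_withDensity_eq_of_sigmaFinite (F := Function.uncurry pc) pcmeas hG hpairs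
      exact DiscEqRel.ae_pairCount_swap hC hDm hD
        (P := fun q => pc q.1 q.2 = W.p q.2 q.1 * D q.1 q.2)
        (measurableSet_eq_fun pcmeas hG) hae
    · conv_rhs => rw [← hfst, hdis]
      refine Measure.ext_of_lintegral _ fun H hH => ?_
      rw [lintegral_map hH measurable_fst,
        DiscEqRel.lintegral_bind_revKer hB (H := fun z => H z.1) (hH.comp measurable_fst),
        DiscEqRel.lintegral_bind_kern (DiscEqRel.aemeasurable_kern_of_revKer hB) hH]
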